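/- Let ξ, η ∈ L¹(Ω;ℝ^d), let c ≥ 0 and set φ(t) = (c+1)(1−t)^c for t ∈ (0,1]. For m ≥ 1 define the maximum extension e^{∨m}_{∫φ}(β) = ∫₀¹ q_{1−t}(max(β₁,…,β_m)) φ(t) dt, where β₁,…,β_m are independent copies of β, and let E^{∨m}_{∫φ}(ξ) be the convex closed set with support function u ↦ e^{∨m}_{∫φ}(⟨ξ,u⟩). If E^{∨m}_{∫φ}(ξ) = E^{∨m}_{∫φ}(η) for every integer m ≥ 1, then ξ and η have the same distribution. -/

import Mathlib

open MeasureTheory RealInnerProductSpace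

/-- The `t`-quantile of a distribution `ν` on `ℝ`: `q_t = inf {s : ν(-∞,s] ≥ t}`. -/
noncomputable def quantile (ν : Measure ℝ) (t : ℝ) : ℝ :=
  sInf {s : ℝ | t ≤ (ν (Set.Iic s)).toReal}

/-- The distribution of `max(β₁,…,β_m)` for independent copies `β₁,…,β_m` of a random
variable with distribution `ν`. -/
noncomputable def lawIIDMax (m : ℕ) (ν : Measure ℝ) : Measure ℝ :=
  Measure.map (fun v : Fin m → ℝ => ⨆ i, v i) (Measure.pi fun _ : Fin m => ν)

/-- The maximum extension of the spectral sublinear expectation with spectral function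
`φ(t) = (c+1)(1−t)^c`, evaluated on the distribution `ν` of a random variable `β`:
`e^{∨m}_{∫φ}(β) = ∫₀¹ q_{1−t}(max(β₁,…,β_m)) φ(t) dt` with `β₁,…,β_m` independent
copies of `β`. -/
noncomputable def maxExtSpectral (c : ℝ) (m : ℕ) (ν : Measure ℝ) : ℝ :=
  ∫ t in (0:ℝ)..1, quantile (lawIIDMax m ν) (1 - t) * ((c + 1) * (1 - t) ^ c)

/-- The convex closed set `E^{∨m}_{∫φ}(ξ)` with support function
`u ↦ e^{∨m}_{∫φ}(⟨ξ,u⟩)`. -/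
def maxExtSpectralSet {Ω : Type*} [MeasureSpace Ω] {d : ℕ}
    (c : ℝ) (m : ℕ) (ξ : Ω → EuclideanSpace ℝ (Fin d)) :
    Set (EuclideanSpace ℝ (Fin d)) :=
  {x | ∀ u : EuclideanSpace ℝ (Fin d),
    ⟪x, u⟫ ≤ maxExtSpectral c m (Measure.map (fun ω => ⟪ξ ω, u⟫) volume)}

section Quantile

open Set Filter Topology

variable {ν : Measure ℝ} [IsProbabilityMeasure ν]

lemma quantile_le_iff {t : ℝ} (ht : t ∈ Ioo (0 : ℝ) 1) (x : ℝ) :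
    quantile ν t ≤ x ↔ t ≤ ν.real (Iic x) := by
  have hF : ∀ s, (ν (Iic s)).toReal = ProbabilityTheory.cdf ν s := fun s =>
    (ProbabilityTheory.cdf_eq_real ν s).symm
  have hmono := ProbabilityTheory.monotone_cdf ν
  change sInf {s : ℝ | t ≤ (ν (Iic s)).toReal} ≤ x ↔ t ≤ (ν (Iic x)).toReal
  simp only [hF]
  have hbdd : BddBelow {s : ℝ | t ≤ ProbabilityTheory.cdf ν s} := by
    obtain ⟨a, ha⟩ := ((ProbabilityTheory.tendsto_cdf_atBot ν).eventually
      (gt_mem_nhds ht.1)).exists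
    exact ⟨a, fun s hs => le_of_not_gt fun hsa =>
      absurd (hs.trans (hmono hsa.le)) (not_le.mpr ha)⟩
  have hne : {s : ℝ | t ≤ ProbabilityTheory.cdf ν s}.Nonempty := by
    obtain ⟨a, ha⟩ := ((ProbabilityTheory.tendsto_cdf_atTop ν).eventually
      (lt_mem_nhds ht.2)).exists
    exact ⟨a, ha.le⟩
  refine ⟨fun h => ?_, fun h => csInf_le hbdd h⟩
  have hright : Tendsto (ProbabilityTheory.cdf ν) (𝓝[>] x) (𝓝 (ProbabilityTheory.cdf ν x)) :=
    ((ProbabilityTheory.cdf ν).right_continuous x).tendsto.mono_left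
      (nhdsWithin_mono _ Ioi_subset_Ici_self)
  refine ge_of_tendsto hright ?_
  filter_upwards [self_mem_nhdsWithin] with y hy
  obtain ⟨s, hs, hsy⟩ := exists_lt_of_csInf_lt hne (h.trans_lt hy)
  exact le_trans hs (hmono hsy.le)

lemma monotoneOn_quantile : MonotoneOn (quantile ν) (Ioo 0 1) := by
  intro a ha b hb hab
  rw [quantile_le_iff ha]
  exact hab.trans ((quantile_le_iff hb _).1 le_rfl)

lemma aemeasurable_quantile : AEMeasurable (quantile ν) (volume.restrict (Ioo 0 1)) :=
  aemeasurable_restrict_of_monotoneOn measurableSet_Ioo monotoneOn_quantile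

/-- The quantile function transports the uniform distribution on `(0,1)` to `ν`. -/
lemma map_quantile : (volume.restrict (Ioo (0 : ℝ) 1)).map (quantile ν) = ν := by
  symm
  refine Measure.ext_of_Iic _ _ fun x => ?_
  rw [Measure.map_apply_of_aemeasurable aemeasurable_quantile measurableSet_Iic,
    Measure.restrict_apply' measurableSet_Ioo]
  have hset : quantile ν ⁻¹' Iic x ∩ Ioo 0 1 = Iic (ν.real (Iic x)) ∩ Ioo 0 1 := by
    ext t
    simp only [mem_inter_iff, mem_preimage, mem_Iic]
    exact and_congr_left fun ht => quantile_le_iff ht x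
  have hae : (Iic (ν.real (Iic x)) ∩ Ioo 0 1 : Set ℝ) =ᵐ[volume] Ioc 0 (ν.real (Iic x)) := by
    have h : (Iic (ν.real (Iic x)) ∩ Ioo 0 1 : Set ℝ) =ᵐ[volume]
        (Iic (ν.real (Iic x)) ∩ Ioc 0 1 : Set ℝ) :=
      (ae_eq_refl _).inter Ioo_ae_eq_Ioc
    have heq : (Iic (ν.real (Iic x)) ∩ Ioc 0 1 : Set ℝ) = Ioc 0 (ν.real (Iic x)) := by
      rw [inter_comm, Ioc_inter_Iic, min_eq_right measureReal_le_one]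
    rwa [heq] at h
  rw [hset, measure_congr hae, Real.volume_Ioc, sub_zero, ofReal_measureReal]

lemma integrableOn_quantile (hν : Integrable id ν) : IntegrableOn (quantile ν) (Ioo 0 1) := by
  rw [← map_quantile (ν := ν)] at hν
  exact hν.comp_aemeasurable aemeasurable_quantile

lemma integral_comp_quantile {f : ℝ → ℝ} (hf : Measurable f) :
    ∫ t in Ioo 0 1, f (quantile ν t) = ∫ y, f y ∂ν := by
  conv_rhs => rw [← map_quantile (ν := ν)]
  rw [integral_map aemeasurable_quantile hf.aestronglyMeasurable]

lemma integral_quantile_tail_le (hν : Integrable id ν) {s : ℝ} (hs : s ∈ Ico (0 : ℝ) 1) (x : ℝ) :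
    ∫ t in Ioo s 1, quantile ν t ≤ (1 - s) * x + ∫ y, max (y - x) 0 ∂ν := by
  have hq := integrableOn_quantile hν
  have hsub : Ioo s 1 ⊆ Ioo 0 1 := Ioo_subset_Ioo_left hs.1
  have hpos : IntegrableOn (fun t => max (quantile ν t - x) 0) (Ioo 0 1) :=
    (Integrable.sub hq (integrable_const x)).pos_part
  have hcont : Measurable fun y : ℝ => max (y - x) 0 := by fun_prop
  rw [← integral_comp_quantile hcont]
  have h1 : ∫ t in Ioo s 1, quantile ν t
      ≤ ∫ t in Ioo s 1, (x + max (quantile ν t - x) 0) :=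
    integral_mono (hq.mono_set hsub) ((integrable_const x).add (hpos.mono_set hsub))
      fun t => by dsimp only; linarith [le_max_left (quantile ν t - x) 0]
  have h2 : ∫ t in Ioo s 1, (x + max (quantile ν t - x) 0)
      = (1 - s) * x + ∫ t in Ioo s 1, max (quantile ν t - x) 0 := by
    rw [integral_add (integrable_const x) (hpos.mono_set hsub)]
    simp [hs.2.le]
  have h3 : ∫ t in Ioo s 1, max (quantile ν t - x) 0 ≤ ∫ t in Ioo 0 1, max (quantile ν t - x) 0 :=
    setIntegral_mono_set hpos (ae_of_all _ fun t => le_max_right _ _) hsub.eventuallyLE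
  linarith

lemma integral_quantile_tail_eq (hν : Integrable id ν) {s : ℝ} (hs : s ∈ Ioo (0 : ℝ) 1) :
    ∫ t in Ioo s 1, quantile ν t
      = (1 - s) * quantile ν s + ∫ y, max (y - quantile ν s) 0 ∂ν := by
  set x := quantile ν s
  have hq := integrableOn_quantile hν
  have hsub : Ioo s 1 ⊆ Ioo 0 1 := Ioo_subset_Ioo_left hs.1.le
  have hpos : IntegrableOn (fun t => max (quantile ν t - x) 0) (Ioo 0 1) :=
    (Integrable.sub hq (integrable_const x)).pos_part
  have hcont : Measurable fun y : ℝ => max (y - x) 0 := by fun_prop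
  rw [← integral_comp_quantile hcont]
  have h1 : ∫ t in Ioo s 1, quantile ν t
      = ∫ t in Ioo s 1, (x + max (quantile ν t - x) 0) := by
    refine setIntegral_congr_fun measurableSet_Ioo fun t ht => ?_
    have : x ≤ quantile ν t := monotoneOn_quantile hs (hsub ht) ht.1.le
    simp [this]
  have h2 : ∫ t in Ioo s 1, (x + max (quantile ν t - x) 0)
      = (1 - s) * x + ∫ t in Ioo s 1, max (quantile ν t - x) 0 := by
    rw [integral_add (integrable_const x) (hpos.mono_set hsub)]
    simp [hs.2.le]
  have h3 : ∫ t in Ioo 0 1, max (quantile ν t - x) 0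
      = ∫ t in Ioo s 1, max (quantile ν t - x) 0 := by
    refine setIntegral_eq_of_subset_of_forall_sdiff_eq_zero measurableSet_Ioo hsub ?_
    intro t ht
    have hts : t ≤ s := le_of_not_gt fun h => ht.2 ⟨h, ht.1.2⟩
    have : quantile ν t ≤ x := monotoneOn_quantile ht.1 hs hts
    simp [this]
  rw [h1, h2, h3]

lemma quantile_map_const_mul {a t : ℝ} (ha : 0 < a) (ht : t ∈ Ioo (0 : ℝ) 1) :
    quantile (ν.map (a * ·)) t = a * quantile ν t := by
  have : IsProbabilityMeasure (ν.map (a * ·)) :=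
    Measure.isProbabilityMeasure_map (by fun_prop)
  refine eq_of_forall_ge_iff fun x => ?_
  rw [quantile_le_iff ht, map_measureReal_apply (by fun_prop) measurableSet_Iic,
    ← le_div_iff₀' ha, quantile_le_iff ht]
  have : (a * ·) ⁻¹' Iic x = Iic (x / a) := by
    ext y; simp [le_div_iff₀' ha]
  rw [this]

lemma quantile_lawIIDMax {m : ℕ} (hm : 1 ≤ m) {t : ℝ} (ht : 0 ≤ t) :
    quantile (lawIIDMax m ν) t = quantile ν (t ^ ((m : ℝ)⁻¹)) := by
  have : Nonempty (Fin m) := ⟨⟨0, hm⟩⟩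
  unfold quantile
  congr 1
  ext s
  have hmeas : Measurable fun v : Fin m → ℝ => ⨆ i, v i := Measurable.iSup fun i => by fun_prop
  have hpre : (fun v : Fin m → ℝ => ⨆ i, v i) ⁻¹' Iic s = Set.univ.pi fun _ => Iic s := by
    ext v
    rw [mem_preimage, mem_Iic, ciSup_le_iff (Set.finite_range v).bddAbove, mem_univ_pi]
    rfl
  have hm0 : (0 : ℝ) < m := by exact_mod_cast hm
  simp only [mem_ofPred_eq, lawIIDMax]
  rw [Measure.map_apply hmeas measurableSet_Iic, hpre, Measure.pi_pi]
  simp only [Finset.prod_const, Finset.card_univ, Fintype.card_fin, ENNReal.toReal_pow]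
  rw [Real.rpow_inv_le_iff_of_pos ht ENNReal.toReal_nonneg hm0, Real.rpow_natCast]

/-- The maximum extension is a spectral functional with weight `p r ^ (p - 1)`,
`p = m (c + 1)`. -/
lemma maxExtSpectral_eq (c : ℝ) {m : ℕ} (hm : 1 ≤ m) :
    maxExtSpectral c m ν = ∫ r in Ioo 0 1,
      quantile ν r * (m * (c + 1) * r ^ (m * (c + 1) - 1)) := by
  have hm0 : (0 : ℝ) < m := by exact_mod_cast hm
  unfold maxExtSpectral
  rw [intervalIntegral.integral_comp_sub_left
    (fun s => quantile (lawIIDMax m ν) s * ((c + 1) * s ^ c)) 1]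
  simp only [sub_self, sub_zero]
  rw [intervalIntegral.integral_of_le zero_le_one, integral_Ioc_eq_integral_Ioo]
  have key := integral_comp_rpow_Ioi_of_pos
    (g := (Ioo (0 : ℝ) 1).indicator fun s => quantile (lawIIDMax m ν) s * ((c + 1) * s ^ c)) hm0
  have hind : ∀ f : ℝ → ℝ, ∫ r in Ioi 0, (Ioo (0 : ℝ) 1).indicator f r = ∫ r in Ioo 0 1, f r :=
    fun f => by
      rw [setIntegral_indicator measurableSet_Ioo,
        inter_eq_right.2 (Ioo_subset_Ioi_self : Ioo (0 : ℝ) 1 ⊆ Ioi 0)]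
  rw [hind] at key
  rw [← key, ← hind]
  refine setIntegral_congr_fun measurableSet_Ioi fun r hr => ?_
  have hr0 : (0 : ℝ) < r := hr
  by_cases hr1 : r < 1
  · have h1 : r ^ (m : ℝ) ∈ Ioo (0 : ℝ) 1 :=
      ⟨Real.rpow_pos_of_pos hr0 _, Real.rpow_lt_one hr0.le hr1 hm0⟩
    rw [indicator_of_mem h1, indicator_of_mem (show r ∈ Ioo (0 : ℝ) 1 from ⟨hr0, hr1⟩),
      quantile_lawIIDMax hm h1.1.le, Real.rpow_rpow_inv hr0.le hm0.ne', ← Real.rpow_mul hr0.le,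
      smul_eq_mul]
    have : r ^ (m * (c + 1) - 1) = r ^ ((m : ℝ) - 1) * r ^ (m * c) := by
      rw [← Real.rpow_add hr0]; congr 1; ring
    rw [this]; ring
  · have h1 : r ^ (m : ℝ) ∉ Ioo (0 : ℝ) 1 := fun h =>
      absurd h.2 (not_lt.2 (Real.one_le_rpow (not_lt.1 hr1) hm0.le))
    rw [indicator_of_notMem h1, indicator_of_notMem (fun h => hr1 h.2), smul_zero]

end Quantile

section Sublinear

open Set Filter Topology

/-- If all upper tail integrals of `D` are nonnegative, so is its integral against a
nonnegative bounded nondecreasing weight. -/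
lemma integral_mul_nonneg_of_tail_nonneg {D w : ℝ → ℝ} {B : ℝ}
    (hD : IntegrableOn D (Ioo 0 1)) (hw : Measurable w) (hmono : MonotoneOn w (Ioo 0 1))
    (hw0 : ∀ r ∈ Ioo (0 : ℝ) 1, 0 ≤ w r) (hwB : ∀ r ∈ Ioo (0 : ℝ) 1, w r ≤ B)
    (htail : ∀ s ∈ Ico (0 : ℝ) 1, 0 ≤ ∫ r in Ioo s 1, D r) :
    0 ≤ ∫ r in Ioo 0 1, D r * w r := by
  let f : ℝ → ℝ → ℝ := fun r y => (Iio (w r)).indicator (fun _ => D r) y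
  have hset : MeasurableSet {z : ℝ × ℝ | z.2 < w z.1} :=
    measurableSet_lt measurable_snd (hw.comp measurable_fst)
  have hf : Integrable (Function.uncurry f)
      ((volume.restrict (Ioo (0 : ℝ) 1)).prod (volume.restrict (Ioo 0 B))) :=
    ((Integrable.comp_fst hD _).indicator hset)
  have hin : ∀ r ∈ Ioo (0 : ℝ) 1, ∫ y in Ioo 0 B, f r y = D r * w r := fun r hr => by
    have hae : (Ioo 0 B ∩ Iio (w r) : Set ℝ) =ᵐ[volume] Ioo 0 (w r) := by
      have h : (Ioo 0 B ∩ Iio (w r) : Set ℝ) =ᵐ[volume] (Ioc 0 B ∩ Iic (w r) : Set ℝ) :=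
        Ioo_ae_eq_Ioc.inter Iio_ae_eq_Iic
      rw [Ioc_inter_Iic, min_eq_right (hwB r hr)] at h
      exact h.trans Ioo_ae_eq_Ioc.symm
    simp only [f]
    rw [setIntegral_indicator measurableSet_Iio, setIntegral_congr_set hae]
    simp [hw0 r hr, mul_comm]
  rw [← setIntegral_congr_fun measurableSet_Ioo hin, integral_integral_swap hf]
  refine integral_nonneg fun y => ?_
  have hA : MeasurableSet {r | y < w r} := measurableSet_lt measurable_const hw
  have hfy : (fun r => f r y) = {r | y < w r}.indicator D := by
    ext r
    simp [f, indicator]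
  change 0 ≤ ∫ r in Ioo 0 1, f r y
  rw [hfy, setIntegral_indicator hA]
  set A := Ioo (0 : ℝ) 1 ∩ {r | y < w r} with hAdef
  rcases A.eq_empty_or_nonempty with h | ⟨a, ha⟩
  · simp [h]
  have hbdd : BddBelow A := ⟨0, fun r hr => hr.1.1.le⟩
  have hsmem : sInf A ∈ Ico (0 : ℝ) 1 :=
    ⟨le_csInf ⟨a, ha⟩ fun r hr => hr.1.1.le, (csInf_le hbdd ha).trans_lt ha.1.2⟩
  have h1 : Ioo (sInf A) 1 ⊆ A := fun r hr => by
    obtain ⟨b, hb, hbr⟩ := exists_lt_of_csInf_lt ⟨a, ha⟩ hr.1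
    have hr' : r ∈ Ioo (0 : ℝ) 1 := ⟨hsmem.1.trans_lt hr.1, hr.2⟩
    exact ⟨hr', lt_of_lt_of_le hb.2 (hmono hb.1 hr' hbr.le)⟩
  have h2 : A ⊆ Ico (sInf A) 1 := fun r hr => ⟨csInf_le hbdd hr, hr.1.2⟩
  have hae : A =ᵐ[volume] Ioo (sInf A) 1 :=
    (h2.eventuallyLE.trans Ioo_ae_eq_Ico.symm.le).antisymm h1.eventuallyLE
  rw [setIntegral_congr_set hae]
  exact htail _ hsmem

variable {Ω : Type*} [MeasurableSpace Ω] {P : Measure Ω} [IsProbabilityMeasure P]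

lemma integral_quantile_tail_add_le {X Y : Ω → ℝ} (hX : Measurable X) (hY : Measurable Y)
    (hXi : Integrable X P) (hYi : Integrable Y P) {s : ℝ} (hs : s ∈ Ico (0 : ℝ) 1) :
    ∫ t in Ioo s 1, quantile (P.map fun ω => X ω + Y ω) t
      ≤ (∫ t in Ioo s 1, quantile (P.map X) t) + ∫ t in Ioo s 1, quantile (P.map Y) t := by
  have hZ : Measurable fun ω => X ω + Y ω := hX.add hY
  have hZi : Integrable (fun ω => X ω + Y ω) P := hXi.add hYi
  have hpX := Measure.isProbabilityMeasure_map (μ := P) hX.aemeasurable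
  have hpY := Measure.isProbabilityMeasure_map (μ := P) hY.aemeasurable
  have hpZ := Measure.isProbabilityMeasure_map (μ := P) hZ.aemeasurable
  have hid : ∀ {W : Ω → ℝ}, Measurable W → Integrable W P → Integrable id (P.map W) :=
    fun hW hWi => (integrable_map_measure aestronglyMeasurable_id hW.aemeasurable).2 hWi
  rcases hs.1.eq_or_lt with rfl | hs0
  · have hE : ∀ {W : Ω → ℝ}, Measurable W → IsProbabilityMeasure (P.map W) →
        ∫ t in Ioo 0 1, quantile (P.map W) t = ∫ ω, W ω ∂P := fun {W} hW _ => by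
      have h := integral_comp_quantile (ν := P.map W) measurable_id
      rw [integral_map hW.aemeasurable aestronglyMeasurable_id] at h
      exact h
    rw [hE hX hpX, hE hY hpY, hE hZ hpZ, integral_add hXi hYi]
  · set x := quantile (P.map X) s
    set y := quantile (P.map Y) s
    have hpos : ∀ {W : Ω → ℝ} (a : ℝ), Measurable W →
        ∫ z, max (z - a) 0 ∂(P.map W) = ∫ ω, max (W ω - a) 0 ∂P := fun a hW =>
      integral_map hW.aemeasurable (by fun_prop)
    have hint : ∀ {W : Ω → ℝ} (a : ℝ), Integrable W P →
        Integrable (fun ω => max (W ω - a) 0) P := fun a hWi =>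
      (hWi.sub (integrable_const a)).pos_part
    rw [integral_quantile_tail_eq (hid hX hXi) ⟨hs0, hs.2⟩,
      integral_quantile_tail_eq (hid hY hYi) ⟨hs0, hs.2⟩, hpos x hX, hpos y hY]
    refine (integral_quantile_tail_le (hid hZ hZi) hs (x + y)).trans ?_
    rw [hpos (x + y) hZ]
    have : ∫ ω, max (X ω + Y ω - (x + y)) 0 ∂P
        ≤ ∫ ω, (max (X ω - x) 0 + max (Y ω - y) 0) ∂P :=
      integral_mono (hint (x + y) hZi) ((hint x hXi).add (hint y hYi)) fun ω => by
        dsimp only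
        refine max_le ?_ (by positivity)
        linarith [le_max_left (X ω - x) 0, le_max_left (Y ω - y) 0]
    rw [integral_add (hint x hXi) (hint y hYi)] at this
    linarith

lemma integrableOn_quantile_mul_rpow {ν : Measure ℝ} [IsProbabilityMeasure ν]
    (hν : Integrable id ν) {a b : ℝ} (hb : 0 ≤ b) :
    IntegrableOn (fun r => quantile ν r * (a * r ^ b)) (Ioo 0 1) := by
  refine Integrable.mul_bdd (c := |a|) (integrableOn_quantile hν) (by fun_prop) ?_
  filter_upwards [ae_restrict_mem measurableSet_Ioo] with r hr
  rw [Real.norm_eq_abs, abs_mul, abs_of_nonneg (Real.rpow_nonneg hr.1.le _)]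
  exact mul_le_of_le_one_right (abs_nonneg a) (Real.rpow_le_one hr.1.le hr.2.le hb)

lemma maxExtSpectral_add_le {c : ℝ} (hc : 0 ≤ c) {m : ℕ} (hm : 1 ≤ m) {X Y : Ω → ℝ}
    (hX : Measurable X) (hY : Measurable Y) (hXi : Integrable X P) (hYi : Integrable Y P) :
    maxExtSpectral c m (P.map fun ω => X ω + Y ω)
      ≤ maxExtSpectral c m (P.map X) + maxExtSpectral c m (P.map Y) := by
  have hZ : Measurable fun ω => X ω + Y ω := hX.add hY
  have hZi : Integrable (fun ω => X ω + Y ω) P := hXi.add hYi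
  have hpX := Measure.isProbabilityMeasure_map (μ := P) hX.aemeasurable
  have hpY := Measure.isProbabilityMeasure_map (μ := P) hY.aemeasurable
  have hpZ := Measure.isProbabilityMeasure_map (μ := P) hZ.aemeasurable
  have hid : ∀ {W : Ω → ℝ}, Measurable W → Integrable W P → Integrable id (P.map W) :=
    fun hW hWi => (integrable_map_measure aestronglyMeasurable_id hW.aemeasurable).2 hWi
  have hm1 : (1 : ℝ) ≤ m := by exact_mod_cast hm
  have hp : 0 ≤ m * (c + 1) - 1 := by nlinarith
  have hp0 : 0 ≤ m * (c + 1) := by linarith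
  rw [maxExtSpectral_eq c hm, maxExtSpectral_eq c hm, maxExtSpectral_eq c hm]
  set p := m * (c + 1)
  have iX := hid hX hXi
  have iY := hid hY hYi
  have iZ := hid hZ hZi
  have qX := integrableOn_quantile iX
  have qY := integrableOn_quantile iY
  have qZ := integrableOn_quantile iZ
  have key := integral_mul_nonneg_of_tail_nonneg (B := p) (w := fun r => p * r ^ (p - 1))
    ((qX.add qY).sub qZ) (by fun_prop)
    (fun r hr s hs hrs => mul_le_mul_of_nonneg_left (Real.rpow_le_rpow hr.1.le hrs hp) hp0)
    (fun r hr => mul_nonneg hp0 (Real.rpow_nonneg hr.1.le _))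
    (fun r hr => mul_le_of_le_one_right hp0 (Real.rpow_le_one hr.1.le hr.2.le hp))
    (fun s hs => by
      have hsub : Ioo s 1 ⊆ Ioo 0 1 := Ioo_subset_Ioo_left hs.1
      rw [integral_sub' ((qX.mono_set hsub).add (qY.mono_set hsub)) (qZ.mono_set hsub),
        integral_add' (qX.mono_set hsub) (qY.mono_set hsub)]
      exact sub_nonneg.2 (integral_quantile_tail_add_le hX hY hXi hYi hs))
  simp only [Pi.sub_apply, Pi.add_apply, sub_mul, add_mul] at key
  have wX := integrableOn_quantile_mul_rpow (a := p) iX hp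
  have wY := integrableOn_quantile_mul_rpow (a := p) iY hp
  rw [integral_sub (by exact wX.add wY) (integrableOn_quantile_mul_rpow iZ hp),
    integral_add wX wY] at key
  linarith

lemma maxExtSpectral_map_const_mul {ν : Measure ℝ} [IsProbabilityMeasure ν] (c : ℝ) {m : ℕ}
    (hm : 1 ≤ m) {a : ℝ} (ha : 0 < a) :
    maxExtSpectral c m (ν.map (a * ·)) = a * maxExtSpectral c m ν := by
  have : IsProbabilityMeasure (ν.map (a * ·)) :=
    Measure.isProbabilityMeasure_map (by fun_prop)
  rw [maxExtSpectral_eq c hm, maxExtSpectral_eq c hm, ← integral_const_mul]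
  refine setIntegral_congr_fun measurableSet_Ioo fun r hr => ?_
  rw [quantile_map_const_mul ha hr, mul_assoc]

variable {E : Type*} [NormedAddCommGroup E] [InnerProductSpace ℝ E] [FiniteDimensional ℝ E]

/-- A finite sublinear functional is the support function of the set it dominates. -/
lemma exists_inner_eq_of_sublinear {N : E → ℝ}
    (hhom : ∀ a : ℝ, 0 < a → ∀ u, N (a • u) = a * N u)
    (hadd : ∀ u v, N (u + v) ≤ N u + N v) (u : E) :
    ∃ x : E, (∀ v, ⟪x, v⟫ ≤ N v) ∧ ⟪x, u⟫ = N u := by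
  have hN0 : N 0 = 0 := by
    have := hhom 2 two_pos 0
    rw [smul_zero] at this
    linarith
  have hle : ∀ k : ℝ, k * N u ≤ N (k • u) := fun k => by
    rcases lt_trichotomy k 0 with hk | rfl | hk
    · have h1 := hadd (k • u) ((-k) • u)
      rw [← add_smul, add_neg_cancel, zero_smul, hN0, hhom (-k) (by linarith)] at h1
      linarith
    · simp [hN0]
    · exact (hhom k hk u).ge
  have hker : ∀ k : ℝ, k • u = 0 → k • N u = 0 := fun k hk => by
    rcases smul_eq_zero.1 hk with rfl | rfl
    · simp
    · simp [hN0]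
  obtain ⟨g, hg, hgN⟩ := exists_extension_of_le_sublinear
    (LinearPMap.mkSpanSingleton' (σ := RingHom.id ℝ) u (N u) hker) N hhom hadd (by
      rintro ⟨x, hx⟩
      obtain ⟨k, rfl⟩ := Submodule.mem_span_singleton.1 hx
      rw [LinearPMap.mkSpanSingleton'_apply]
      exact hle k)
  refine ⟨(InnerProductSpace.toDual ℝ E).symm (LinearMap.toContinuousLinearMap g), ?_, ?_⟩
  · intro v
    simpa using hgN v
  · have h := hg ⟨u, Submodule.mem_span_singleton_self u⟩
    have h' := h.trans (LinearPMap.mkSpanSingleton'_apply_self u (N u) hker _)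
    simpa using h'

lemma sublinear_le_of_subset {N₁ N₂ : E → ℝ}
    (hhom : ∀ a : ℝ, 0 < a → ∀ u, N₁ (a • u) = a * N₁ u)
    (hadd : ∀ u v, N₁ (u + v) ≤ N₁ u + N₁ v)
    (hsub : {x : E | ∀ u, ⟪x, u⟫ ≤ N₁ u} ⊆ {x : E | ∀ u, ⟪x, u⟫ ≤ N₂ u}) (u : E) :
    N₁ u ≤ N₂ u := by
  obtain ⟨x, hx, hxu⟩ := exists_inner_eq_of_sublinear hhom hadd u
  exact hxu ▸ hsub hx u

end Sublinear

section Determination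

open Set Filter Topology

/-- An integrable function on `(0,1)` is determined by its integrals against
`r ^ c * (r ^ (c + 1)) ^ n`, `n : ℕ`. -/
lemma ae_eq_zero_of_integral_mul_rpow_eq_zero {D : ℝ → ℝ} {c : ℝ} (hc : 0 ≤ c)
    (hD : IntegrableOn D (Ioo 0 1))
    (hmom : ∀ n : ℕ, ∫ r in Ioo 0 1, D r * (r ^ c * (r ^ (c + 1)) ^ n) = 0) :
    ∀ᵐ r ∂volume.restrict (Ioo (0 : ℝ) 1), D r = 0 := by
  have hc1 : 0 < c + 1 := by linarith
  let G : ℝ → ℝ := fun r => D r * r ^ c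
  have hG : IntegrableOn G (Ioo 0 1) := by
    refine Integrable.mul_bdd (c := 1) hD (by fun_prop) ?_
    filter_upwards [ae_restrict_mem measurableSet_Ioo] with r hr
    rw [Real.norm_eq_abs, abs_of_nonneg (Real.rpow_nonneg hr.1.le _)]
    exact Real.rpow_le_one hr.1.le hr.2.le hc
  have hbound : ∀ {f : ℝ → ℝ} {K : ℝ}, Measurable f → (∀ r ∈ Ioo (0 : ℝ) 1, |f r| ≤ K) →
      IntegrableOn (fun r => f r * G r) (Ioo 0 1) := fun {f K} hf hK => by
    refine Integrable.bdd_mul (c := K) hG hf.aestronglyMeasurable ?_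
    filter_upwards [ae_restrict_mem measurableSet_Ioo] with r hr using hK r hr
  have hmonomial : ∀ (a : ℝ) (n : ℕ),
      IntegrableOn (fun r => a * (r ^ (c + 1)) ^ n * G r) (Ioo 0 1) := fun a n => by
    refine hbound (K := |a|) (by fun_prop) fun r hr => ?_
    have h0 := Real.rpow_nonneg hr.1.le (c + 1)
    rw [abs_mul, abs_of_nonneg (pow_nonneg h0 n)]
    exact mul_le_of_le_one_right (abs_nonneg a)
      (pow_le_one₀ h0 (Real.rpow_le_one hr.1.le hr.2.le hc1.le))
  have hpolyint : ∀ p : Polynomial ℝ,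
      IntegrableOn (fun r => p.eval (r ^ (c + 1)) * G r) (Ioo 0 1) := fun p => by
    simp only [Polynomial.eval_eq_sum_range, Finset.sum_mul]
    exact integrable_finsetSum _ fun i _ => hmonomial _ _
  have hpoly : ∀ p : Polynomial ℝ, ∫ r in Ioo 0 1, p.eval (r ^ (c + 1)) * G r = 0 := fun p => by
    simp only [Polynomial.eval_eq_sum_range, Finset.sum_mul]
    rw [integral_finsetSum _ fun i _ => hmonomial _ _]
    refine Finset.sum_eq_zero fun i _ => ?_
    have : ∀ r, p.coeff i * (r ^ (c + 1)) ^ i * G r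
        = p.coeff i * (D r * (r ^ c * (r ^ (c + 1)) ^ i)) := fun r => by
      simp only [G]; ring
    simp only [this]
    rw [integral_const_mul, hmom, mul_zero]
  have hcont : ∀ g : ℝ → ℝ, Continuous g → ∫ r in Ioo 0 1, g r * G r = 0 := by
    intro g hg
    set K := ∫ r in Ioo 0 1, |G r|
    have hK : 0 ≤ K := integral_nonneg fun r => abs_nonneg _
    obtain ⟨C, hC⟩ := isCompact_Icc.exists_bound_of_continuousOn (s := Icc (0 : ℝ) 1)
      hg.continuousOn
    have hgint : IntegrableOn (fun r => g r * G r) (Ioo 0 1) :=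
      hbound hg.measurable fun r hr => hC r (Ioo_subset_Icc_self hr)
    have happrox : ∀ ε > 0, |∫ r in Ioo 0 1, g r * G r| ≤ ε * K := fun ε hε => by
      have hf : Continuous fun t : ℝ => g (t ^ (c + 1)⁻¹) :=
        hg.comp (Real.continuous_rpow_const (inv_nonneg.2 hc1.le))
      obtain ⟨p, hp⟩ := exists_polynomial_near_of_continuousOn 0 1 _ hf.continuousOn ε hε
      have hsub : ∫ r in Ioo 0 1, g r * G r
          = ∫ r in Ioo 0 1, (g r * G r - p.eval (r ^ (c + 1)) * G r) := by
        rw [integral_sub hgint (hpolyint p), hpoly, sub_zero]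
      rw [hsub, ← integral_const_mul, ← Real.norm_eq_abs]
      refine norm_integral_le_of_norm_le (hG.abs.const_mul ε) ?_
      filter_upwards [ae_restrict_mem measurableSet_Ioo] with r hr
      have h := hp (r ^ (c + 1)) ⟨Real.rpow_nonneg hr.1.le _,
        Real.rpow_le_one hr.1.le hr.2.le hc1.le⟩
      rw [Real.rpow_rpow_inv hr.1.le hc1.ne', abs_sub_comm] at h
      rw [← sub_mul, Real.norm_eq_abs, abs_mul]
      exact mul_le_mul_of_nonneg_right h.le (abs_nonneg _)
    by_contra hne
    have hpos := abs_pos.2 hne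
    have h := happrox (|∫ r in Ioo 0 1, g r * G r| / (K + 1)) (by positivity)
    rw [div_mul_eq_mul_div, le_div_iff₀ (by linarith)] at h
    nlinarith
  have hae : ∀ᵐ r ∂volume, r ∈ Ioo (0 : ℝ) 1 → G r = 0 := by
    refine isOpen_Ioo.ae_eq_zero_of_integral_contDiff_smul_eq_zero hG.locallyIntegrableOn ?_
    intro g hg _ hsupp
    rw [← hcont g hg.continuous]
    symm
    refine setIntegral_eq_integral_of_forall_compl_eq_zero fun r hr => ?_
    rw [image_eq_zero_of_notMem_tsupport fun h => hr (hsupp h), zero_mul]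
  rw [ae_restrict_iff' measurableSet_Ioo]
  filter_upwards [hae] with r hr hr01
  exact (mul_eq_zero.1 (hr hr01)).resolve_right (Real.rpow_pos_of_pos hr01.1 _).ne'

/-- A distribution with finite mean is determined by the values of all maximum extensions of
the spectral expectation. -/
lemma eq_of_maxExtSpectral_eq {μ ν : Measure ℝ} [IsProbabilityMeasure μ] [IsProbabilityMeasure ν]
    (hμ : Integrable id μ) (hν : Integrable id ν) {c : ℝ} (hc : 0 ≤ c)
    (h : ∀ m : ℕ, 1 ≤ m → maxExtSpectral c m μ = maxExtSpectral c m ν) : μ = ν := by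
  have hD := (integrableOn_quantile hμ).sub (integrableOn_quantile hν)
  have hae := ae_eq_zero_of_integral_mul_rpow_eq_zero hc hD fun n => by
    have hp0 : ((n + 1 : ℕ) : ℝ) * (c + 1) ≠ 0 := by positivity
    have hp : 0 ≤ ((n + 1 : ℕ) : ℝ) * (c + 1) - 1 := by
      push_cast
      have : 0 ≤ (n : ℝ) * (c + 1) := by positivity
      linarith
    have hn := h (n + 1) (by omega)
    rw [maxExtSpectral_eq c (by omega), maxExtSpectral_eq c (by omega), ← sub_eq_zero,
      ← integral_sub (integrableOn_quantile_mul_rpow hμ hp)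
        (integrableOn_quantile_mul_rpow hν hp)] at hn
    refine (mul_eq_zero.1 (Eq.trans ?_ hn)).resolve_left hp0
    rw [← integral_const_mul]
    refine setIntegral_congr_fun measurableSet_Ioo fun r hr => ?_
    have hr' : r ^ (((n + 1 : ℕ) : ℝ) * (c + 1) - 1) = r ^ c * (r ^ (c + 1)) ^ n := by
      rw [← Real.rpow_natCast (r ^ (c + 1)), ← Real.rpow_mul hr.1.le, ← Real.rpow_add hr.1]
      congr 1
      push_cast
      ring
    simp only [Pi.sub_apply, hr']
    ring
  rw [← map_quantile (ν := μ), ← map_quantile (ν := ν)]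
  refine Measure.map_congr ?_
  filter_upwards [hae] with r hr using sub_eq_zero.1 hr

/-- The Cramér–Wold device: the laws of all linear functionals determine a distribution. -/
lemma map_eq_of_map_inner_eq {Ω E : Type*} [MeasurableSpace Ω] {P : Measure Ω}
    [IsProbabilityMeasure P] [NormedAddCommGroup E] [InnerProductSpace ℝ E]
    [FiniteDimensional ℝ E] [MeasurableSpace E] [BorelSpace E] {ξ η : Ω → E}
    (hξ : Measurable ξ) (hη : Measurable η)
    (h : ∀ u : E, P.map (fun ω => ⟪ξ ω, u⟫) = P.map fun ω => ⟪η ω, u⟫) :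
    P.map ξ = P.map η := by
  have := Measure.isProbabilityMeasure_map (μ := P) hξ.aemeasurable
  have := Measure.isProbabilityMeasure_map (μ := P) hη.aemeasurable
  have : CompleteSpace E := FiniteDimensional.complete ℝ E
  have := FiniteDimensional.proper_real E
  have : SecondCountableTopology E := inferInstance
  refine Measure.ext_of_charFun (funext fun u => ?_)
  have key : ∀ {ζ : Ω → E}, Measurable ζ → charFun (P.map ζ) u
      = ∫ y : ℝ, Complex.exp (y * Complex.I) ∂(P.map fun ω => ⟪ζ ω, u⟫) := fun {ζ} hζ => by
    rw [charFun_apply, integral_map hζ.aemeasurable (by fun_prop),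
      integral_map (by fun_prop) (by fun_prop)]
  rw [key hξ, key hη, h u]

end Determination

/-- let `ξ, η ∈ L¹(Ω;ℝ^d)`, `c ≥ 0` and `φ(t) = (c+1)(1−t)^c`. If the
convex bodies `E^{∨m}_{∫φ}(ξ)` and `E^{∨m}_{∫φ}(η)` coincide for every integer `m ≥ 1`,
then `ξ` and `η` have the same distribution. -/
theorem statement14
    {Ω : Type*} [MeasureSpace Ω] [IsProbabilityMeasure (volume : Measure Ω)]
    {d : ℕ}
    (ξ η : Ω → EuclideanSpace ℝ (Fin d))
    (hξmeas : Measurable ξ) (hηmeas : Measurable η)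
    (hξint : Integrable ξ) (hηint : Integrable η)
    (c : ℝ) (hc : 0 ≤ c)
    (hsets : ∀ m : ℕ, 1 ≤ m → maxExtSpectralSet c m ξ = maxExtSpectralSet c m η) :
    Measure.map ξ volume = Measure.map η volume := by
  have hid : ∀ {ζ : Ω → EuclideanSpace ℝ (Fin d)}, Measurable ζ → Integrable ζ →
      ∀ u, Measurable (fun ω => ⟪ζ ω, u⟫) ∧ Integrable (fun ω => ⟪ζ ω, u⟫) :=
    fun hζ hζi u => ⟨by fun_prop, hζi.inner_const u⟩
  have hadd : ∀ {ζ : Ω → EuclideanSpace ℝ (Fin d)}, Measurable ζ → Integrable ζ →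
      ∀ m : ℕ, 1 ≤ m → ∀ u v,
        maxExtSpectral c m (Measure.map (fun ω => ⟪ζ ω, u + v⟫) volume)
          ≤ maxExtSpectral c m (Measure.map (fun ω => ⟪ζ ω, u⟫) volume)
            + maxExtSpectral c m (Measure.map (fun ω => ⟪ζ ω, v⟫) volume) :=
    fun hζ hζi m hm u v => by
      simp only [inner_add_right]
      exact maxExtSpectral_add_le hc hm (hid hζ hζi u).1 (hid hζ hζi v).1
        (hid hζ hζi u).2 (hid hζ hζi v).2
  have hhom : ∀ {ζ : Ω → EuclideanSpace ℝ (Fin d)}, Measurable ζ → Integrable ζ →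
      ∀ m : ℕ, 1 ≤ m → ∀ a : ℝ, 0 < a → ∀ u,
        maxExtSpectral c m (Measure.map (fun ω => ⟪ζ ω, a • u⟫) volume)
          = a * maxExtSpectral c m (Measure.map (fun ω => ⟪ζ ω, u⟫) volume) :=
    fun {ζ} hζ hζi m hm a ha u => by
      have hm1 := (hid hζ hζi u).1
      have := Measure.isProbabilityMeasure_map (μ := volume) hm1.aemeasurable
      rw [← maxExtSpectral_map_const_mul c hm ha,
        Measure.map_map (measurable_const_mul a) hm1]
      simp only [inner_smul_right, Function.comp_def]
  refine map_eq_of_map_inner_eq hξmeas hηmeas fun u => ?_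
  have hξu := hid hξmeas hξint u
  have hηu := hid hηmeas hηint u
  have := Measure.isProbabilityMeasure_map (μ := volume) hξu.1.aemeasurable
  have := Measure.isProbabilityMeasure_map (μ := volume) hηu.1.aemeasurable
  refine eq_of_maxExtSpectral_eq
    ((integrable_map_measure aestronglyMeasurable_id hξu.1.aemeasurable).2 hξu.2)
    ((integrable_map_measure aestronglyMeasurable_id hηu.1.aemeasurable).2 hηu.2) hc
    fun m hm => le_antisymm ?_ ?_
  · exact sublinear_le_of_subset (hhom hξmeas hξint m hm) (hadd hξmeas hξint m hm)
      (hsets m hm).subset u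
  · exact sublinear_le_of_subset (hhom hηmeas hηint m hm) (hadd hηmeas hηint m hm)
      (hsets m hm).superset u
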